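/- Let H be a complex Hilbert space and (T_t)_{t≥0} a bounded C₀-semigroup on H with generator −A; set C_A = sup_{t≥0} ‖T_t‖. For finite families (c_j) and (d_j) in L^1(ℝ₊) and b = Σ_j c_j ∗ d_j, one has ‖∫₀^∞ b(t) T_t dt‖ ≤ C_A² γ₂*(Σ_j c_j ⊗ d_j). Consequently the linear map taking c ⊗ d to Γ(A, c ∗ d) extends to a bounded operator σ_A : L^1(ℝ₊) ⊗_{γ₂*} L^1(ℝ₊) → B(H) with ‖σ_A‖ ≤ C_A². -/

import Mathlib

open MeasureTheory Complex Filter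
open scoped ENNReal NNReal ZeroAtInfty Topology BoundedContinuousFunction

noncomputable section

set_option synthInstance.maxHeartbeats 1000000
set_option maxHeartbeats 1000000

/-- Lebesgue measure on `ℝ₊`. -/
def μplus : Measure ℝ := volume.restrict (Set.Ioi (0 : ℝ))

/-- `L¹(ℝ₊)`. -/
abbrev L1p : Type := Lp ℂ 1 μplus

/-- `L^∞(ℝ₊)`. -/
abbrev Linfp : Type := Lp ℂ ⊤ μplus

/-- The convolution `(c ∗ d)(t) = ∫₀ᵗ c(s) d(t-s) ds` of two functions on `ℝ₊`. -/
def convP (c d : ℝ → ℂ) (t : ℝ) : ℂ := ∫ s in Set.Ioo (0 : ℝ) t, c s * d (t - s)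

/-- The norm `γ₂*` of the tensor `Σⱼ cⱼ ⊗ dⱼ ∈ L¹(ℝ₊) ⊗ L¹(ℝ₊)`, computed by duality
against the unit ball of `Γ₂(L¹(ℝ₊), L^∞(ℝ₊))`. -/
def gamma2star {N : ℕ} (c d : Fin N → L1p) : ℝ :=
  sSup {r | ∃ (𝓗 : Type) (_ : NormedAddCommGroup 𝓗) (_ : InnerProductSpace ℂ 𝓗)
      (A : L1p →L[ℂ] 𝓗) (B : 𝓗 →L[ℂ] Linfp), ‖A‖ * ‖B‖ ≤ 1 ∧
      r = ‖∑ j, ∫ s, ((B (A (d j)) : ℝ → ℂ) s) * ((c j : ℝ → ℂ) s) ∂μplus‖}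

section Helpers

variable {H : Type} [NormedAddCommGroup H] [InnerProductSpace ℂ H] [CompleteSpace H]

lemma orbit_aesm {T : ℝ → (H →L[ℂ] H)}
    (hTcont : ∀ x : H, ContinuousOn (fun t => T t x) (Set.Ici (0 : ℝ))) (x : H) :
    AEStronglyMeasurable (fun t => T t x) μplus :=
  ((hTcont x).mono Set.Ioi_subset_Ici_self).aestronglyMeasurable measurableSet_Ioi

lemma ae_pos_μplus : ∀ᵐ t ∂μplus, 0 < t := ae_restrict_mem measurableSet_Ioi

lemma orbit_bound {T : ℝ → (H →L[ℂ] H)} {C : ℝ} (hC : ∀ t : ℝ, 0 ≤ t → ‖T t‖ ≤ C) (x : H) :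
    ∀ᵐ t ∂μplus, ‖T t x‖ ≤ C * ‖x‖ := by
  filter_upwards [ae_pos_μplus] with t ht
  exact (T t).le_of_opNorm_le (hC t ht.le) x

lemma orbit_integrable {T : ℝ → (H →L[ℂ] H)}
    (hTcont : ∀ x : H, ContinuousOn (fun t => T t x) (Set.Ici (0 : ℝ)))
    {C : ℝ} (hC : ∀ t : ℝ, 0 ≤ t → ‖T t‖ ≤ C) (c : L1p) (x : H) :
    Integrable (fun t => c t • T t x) μplus :=
  (L1.integrable_coeFn c).smul_bdd (C * ‖x‖) (orbit_aesm hTcont x) (orbit_bound hC x)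

lemma exists_S {T : ℝ → (H →L[ℂ] H)}
    (hTcont : ∀ x : H, ContinuousOn (fun t => T t x) (Set.Ici (0 : ℝ)))
    {C : ℝ} (hC : ∀ t : ℝ, 0 ≤ t → ‖T t‖ ≤ C) :
    ∃ S : L1p →L[ℂ] (H →L[ℂ] H), ‖S‖ ≤ C ∧ ∀ c x, S c x = ∫ t, c t • T t x ∂μplus := by
  have hC0 : 0 ≤ C := (norm_nonneg _).trans (hC 0 le_rfl)
  let f : L1p →ₗ[ℂ] H →ₗ[ℂ] H := LinearMap.mk₂ ℂ (fun c x => ∫ t, c t • T t x ∂μplus)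
    (by
      intro c d x
      rw [← integral_add (orbit_integrable hTcont hC c x) (orbit_integrable hTcont hC d x)]
      apply integral_congr_ae
      filter_upwards [Lp.coeFn_add c d] with t ht
      rw [ht, Pi.add_apply, add_smul])
    (by
      intro a c x
      rw [← integral_smul]
      apply integral_congr_ae
      filter_upwards [Lp.coeFn_smul a c] with t ht
      rw [ht, Pi.smul_apply, smul_assoc])
    (by
      intro c x y
      rw [← integral_add (orbit_integrable hTcont hC c x) (orbit_integrable hTcont hC c y)]
      simp only [map_add, smul_add])
    (by
      intro a c x
      rw [← integral_smul]
      simp only [map_smul]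
      simp only [smul_comm a])
  have hb : ∀ c x, ‖f c x‖ ≤ C * ‖c‖ * ‖x‖ := by
    intro c x
    change ‖∫ t, c t • T t x ∂μplus‖ ≤ _
    calc _ ≤ ∫ t, ‖c t‖ * (C * ‖x‖) ∂μplus := by
            apply norm_integral_le_of_norm_le ((L1.integrable_coeFn c).norm.mul_const _)
            filter_upwards [orbit_bound hC x] with t ht
            rw [norm_smul]
            gcongr
      _ = _ := by
            rw [integral_mul_const, ← L1.norm_eq_integral_norm]; ring
  exact ⟨f.mkContinuous₂ C hb, LinearMap.mkContinuous₂_norm_le _ hC0 _, fun c x => rfl⟩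

lemma exists_B {T : ℝ → (H →L[ℂ] H)}
    (hTcont : ∀ x : H, ContinuousOn (fun t => T t x) (Set.Ici (0 : ℝ)))
    {C : ℝ} (hC : ∀ t : ℝ, 0 ≤ t → ‖T t‖ ≤ C) (y : H) :
    ∃ B : H →L[ℂ] Linfp, ‖B‖ ≤ C * ‖y‖ ∧ ∀ h, ∀ᵐ t ∂μplus, B h t = inner ℂ y (T t h) := by
  have hC0 : 0 ≤ C := (norm_nonneg _).trans (hC 0 le_rfl)
  have hm : ∀ h, AEStronglyMeasurable (fun t => inner ℂ y (T t h)) μplus := fun h =>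
    aestronglyMeasurable_const.inner (orbit_aesm hTcont h)
  have hbd : ∀ h, ∀ᵐ t ∂μplus, ‖inner ℂ y (T t h)‖ ≤ C * ‖y‖ * ‖h‖ := by
    intro h
    filter_upwards [orbit_bound hC h] with t ht
    calc _ ≤ ‖y‖ * ‖T t h‖ := norm_inner_le_norm _ _
      _ ≤ ‖y‖ * (C * ‖h‖) := by gcongr
      _ = _ := by ring
  have hL : ∀ h, MemLp (fun t => inner ℂ y (T t h)) ⊤ μplus := fun h =>
    memLp_top_of_bound (hm h) _ (hbd h)
  let f : H →ₗ[ℂ] Linfp :=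
    { toFun := fun h => (hL h).toLp _
      map_add' := by
        intro a b
        rw [← MemLp.toLp_add]
        congr 1
        ext t
        simp [inner_add_right]
      map_smul' := by
        intro a b
        rw [RingHom.id_apply, ← MemLp.toLp_const_smul]
        congr 1
        ext t
        simp [inner_smul_right] }
  have hb : ∀ h, ‖f h‖ ≤ C * ‖y‖ * ‖h‖ := by
    intro h
    change ‖(hL h).toLp _‖ ≤ _
    rw [Lp.norm_toLp]
    apply ENNReal.toReal_le_of_le_ofReal (by positivity)
    rw [eLpNorm_exponent_top]
    exact eLpNormEssSup_le_of_ae_bound (hbd h)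
  exact ⟨f.mkContinuous _ hb, LinearMap.mkContinuous_norm_le _ (by positivity) _,
    fun h => (hL h).coeFn_toLp⟩

lemma pair_bound (F : Linfp) (c : L1p) : ‖∫ s, F s * c s ∂μplus‖ ≤ ‖F‖ * ‖c‖ := by
  have hF : ∀ᵐ s ∂μplus, ‖F s‖ ≤ ‖F‖ := by
    filter_upwards [ae_le_eLpNormEssSup (f := F) (μ := μplus)] with s hs
    rw [Lp.norm_def, eLpNorm_exponent_top, ← toReal_enorm]
    refine ENNReal.toReal_mono ?_ hs
    rw [← eLpNorm_exponent_top]; exact Lp.eLpNorm_ne_top F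
  rw [L1.norm_eq_integral_norm, ← integral_const_mul]
  apply norm_integral_le_of_norm_le ((L1.integrable_coeFn c).norm.const_mul _)
  filter_upwards [hF] with s hs
  rw [norm_mul]; gcongr

lemma gamma2star_bdd {N : ℕ} (c d : Fin N → L1p) :
    BddAbove {r | ∃ (𝓗 : Type) (_ : NormedAddCommGroup 𝓗) (_ : InnerProductSpace ℂ 𝓗)
      (A : L1p →L[ℂ] 𝓗) (B : 𝓗 →L[ℂ] Linfp), ‖A‖ * ‖B‖ ≤ 1 ∧
      r = ‖∑ j, ∫ s, ((B (A (d j)) : ℝ → ℂ) s) * ((c j : ℝ → ℂ) s) ∂μplus‖} := by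
  refine ⟨∑ j, ‖d j‖ * ‖c j‖, ?_⟩
  rintro r ⟨K, _, _, A, B, hAB, rfl⟩
  refine (norm_sum_le _ _).trans (Finset.sum_le_sum fun j _ => (pair_bound _ _).trans ?_)
  gcongr
  calc _ ≤ ‖B‖ * (‖A‖ * ‖d j‖) := B.le_opNorm_of_le (A.le_opNorm _)
    _ = (‖A‖ * ‖B‖) * ‖d j‖ := by ring
    _ ≤ 1 * ‖d j‖ := by gcongr
    _ = _ := one_mul _

lemma gamma2star_nonneg {N : ℕ} (c d : Fin N → L1p) : 0 ≤ gamma2star c d := by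
  apply Real.sSup_nonneg
  rintro r ⟨K, _, _, A, B, hAB, rfl⟩
  positivity

lemma le_gamma2star {N : ℕ} (c d : Fin N → L1p) {K : Type} [NormedAddCommGroup K]
    [InnerProductSpace ℂ K] (A : L1p →L[ℂ] K) (B : K →L[ℂ] Linfp) :
    ‖∑ j, ∫ s, ((B (A (d j)) : ℝ → ℂ) s) * ((c j : ℝ → ℂ) s) ∂μplus‖
      ≤ (‖A‖ * ‖B‖) * gamma2star c d := by
  have hz : ∀ j, ∫ s, ((0 : Linfp) : ℝ → ℂ) s * ((c j : ℝ → ℂ) s) ∂μplus = 0 := by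
    intro j
    have := pair_bound 0 (c j)
    simpa using this
  by_cases hA : ‖A‖ = 0
  · rw [norm_eq_zero] at hA
    subst hA
    simp only [ContinuousLinearMap.zero_apply, map_zero, hz]
    simp
  by_cases hB : ‖B‖ = 0
  · rw [norm_eq_zero] at hB
    subst hB
    simp only [ContinuousLinearMap.zero_apply, hz]
    simp
  set k : ℝ := ‖A‖ * ‖B‖ with hk
  have hk0 : 0 < k := by positivity
  have hmem := le_csSup (gamma2star_bdd c d)
    ⟨K, inferInstance, inferInstance, ((k⁻¹ : ℝ) : ℂ) • A, B, by
      rw [norm_smul, mul_assoc, ← hk, Complex.norm_real, Real.norm_of_nonneg (by positivity)]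
      exact (inv_mul_cancel₀ hk0.ne').le, rfl⟩
  change _ ≤ gamma2star c d at hmem
  have he : ∀ j, ∫ s, ((B ((((k⁻¹ : ℝ) : ℂ) • A) (d j)) : ℝ → ℂ) s) * ((c j : ℝ → ℂ) s) ∂μplus
      = ((k⁻¹ : ℝ) : ℂ) * ∫ s, ((B (A (d j)) : ℝ → ℂ) s) * ((c j : ℝ → ℂ) s) ∂μplus := by
    intro j
    rw [← integral_const_mul]
    apply integral_congr_ae
    rw [ContinuousLinearMap.smul_apply, map_smul]
    filter_upwards [Lp.coeFn_smul ((k⁻¹ : ℝ) : ℂ) (B (A (d j)))] with s hs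
    rw [hs, Pi.smul_apply, smul_eq_mul, mul_assoc]
  simp only [he] at hmem
  rw [← Finset.mul_sum, norm_mul, Complex.norm_real, Real.norm_of_nonneg (by positivity)] at hmem
  rwa [inv_mul_le_iff₀ hk0] at hmem

lemma S_sum_bound {T : ℝ → (H →L[ℂ] H)}
    (hTcont : ∀ x : H, ContinuousOn (fun t => T t x) (Set.Ici (0 : ℝ)))
    {C : ℝ} (hC : ∀ t : ℝ, 0 ≤ t → ‖T t‖ ≤ C)
    {S : L1p →L[ℂ] (H →L[ℂ] H)} (hSn : ‖S‖ ≤ C)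
    (hS : ∀ c x, S c x = ∫ t, c t • T t x ∂μplus)
    {N : ℕ} (c d : Fin N → L1p) :
    ‖∑ i, (S (c i)).comp (S (d i))‖ ≤ C ^ 2 * gamma2star c d := by
  have hC0 : 0 ≤ C := (norm_nonneg _).trans (hC 0 le_rfl)
  have hg := gamma2star_nonneg c d
  have key : ∀ x y : H, ‖inner ℂ y ((∑ i, (S (c i)).comp (S (d i))) x)‖
      ≤ C ^ 2 * gamma2star c d * ‖x‖ * ‖y‖ := by
    intro x y
    obtain ⟨B, hBn, hB⟩ := exists_B hTcont hC y
    have h1 := le_gamma2star c d (S.flip x) B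
    have h2 : ∀ i, ∫ s, ((B (S.flip x (d i)) : ℝ → ℂ) s) * ((c i : ℝ → ℂ) s) ∂μplus
        = inner ℂ y (S (c i) (S (d i) x)) := by
      intro i
      rw [hS (c i), ← integral_inner (orbit_integrable hTcont hC _ _)]
      apply integral_congr_ae
      filter_upwards [hB (S.flip x (d i))] with s hs
      rw [hs, inner_smul_right, mul_comm]
      rfl
    simp only [h2] at h1
    rw [ContinuousLinearMap.sum_apply, inner_sum]
    refine h1.trans ?_
    have hA : ‖S.flip x‖ ≤ C * ‖x‖ := by
      refine (S.flip.le_opNorm x).trans ?_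
      rw [ContinuousLinearMap.opNorm_flip]
      gcongr
    calc _ ≤ ((C * ‖x‖) * (C * ‖y‖)) * gamma2star c d := by gcongr
      _ = _ := by ring
  refine ContinuousLinearMap.opNorm_le_bound _ (by positivity) fun x => ?_
  set z := (∑ i, (S (c i)).comp (S (d i))) x with hz
  have h := key x z
  rw [← hz, inner_self_eq_norm_sq_to_K] at h
  rcases (norm_nonneg z).eq_or_lt with h0 | h0
  · rw [← h0]; positivity
  · have h' : ‖z‖ * ‖z‖ ≤ (C ^ 2 * gamma2star c d * ‖x‖) * ‖z‖ := by
      simpa [sq] using h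
    exact le_of_mul_le_mul_right h' h0

lemma conv_identity {T : ℝ → (H →L[ℂ] H)}
    (hTsemi : ∀ s t : ℝ, 0 ≤ s → 0 ≤ t → T (s + t) = (T s).comp (T t))
    (hTcont : ∀ x : H, ContinuousOn (fun t => T t x) (Set.Ici (0 : ℝ)))
    {C : ℝ} (hC : ∀ t : ℝ, 0 ≤ t → ‖T t‖ ≤ C)
    {S : L1p →L[ℂ] (H →L[ℂ] H)}
    (hS : ∀ c x, S c x = ∫ t, c t • T t x ∂μplus)
    (c d : L1p) (x : H) :
    Integrable (fun t => convP c d t • T t x) μplus ∧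
    S c (S d x) = ∫ t in Set.Ioi (0 : ℝ), convP (c : ℝ → ℂ) (d : ℝ → ℂ) t • T t x := by
  have hC0 : 0 ≤ C := (norm_nonneg _).trans (hC 0 le_rfl)
  set f : ℝ → ℂ := (Set.Ioi (0 : ℝ)).indicator c with hf
  set g : ℝ → ℂ := (Set.Ioi (0 : ℝ)).indicator d with hg
  set τ : ℝ → H := (Set.Ioi (0 : ℝ)).indicator (fun t => T t x) with hτ
  have hfi : Integrable f volume :=
    (integrable_indicator_iff measurableSet_Ioi).2 (L1.integrable_coeFn c)
  have hgi : Integrable g volume :=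
    (integrable_indicator_iff measurableSet_Ioi).2 (L1.integrable_coeFn d)
  have hτm : AEStronglyMeasurable τ volume :=
    (aestronglyMeasurable_indicator_iff measurableSet_Ioi).2 (orbit_aesm hTcont x)
  have hτb : ∀ t, ‖τ t‖ ≤ C * ‖x‖ := by
    intro t
    by_cases ht : t ∈ Set.Ioi (0 : ℝ)
    · rw [hτ, Set.indicator_of_mem ht]
      exact (T t).le_of_opNorm_le (hC t (le_of_lt ht)) x
    · rw [hτ, Set.indicator_of_notMem ht, norm_zero]; positivity
  have hprod : Integrable (fun p : ℝ × ℝ => f p.2 * g (p.1 - p.2)) (volume.prod volume) :=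
    hfi.convolution_integrand (ContinuousLinearMap.mul ℂ ℂ) hgi
  have hF : Integrable (fun p : ℝ × ℝ => (f p.2 * g (p.1 - p.2)) • τ p.1)
      (volume.prod volume) :=
    hprod.smul_bdd (C * ‖x‖) hτm.comp_fst (ae_of_all _ fun p => hτb p.1)
  have hconv : ∀ t, convP c d t = ∫ s, f s * g (t - s) := by
    intro t
    rw [convP, ← integral_indicator measurableSet_Ioo]
    congr 1
    ext s
    by_cases h1 : 0 < s <;> by_cases h2 : s < t <;>
      simp [hf, hg, Set.indicator_apply, h1, h2]
  have hconvτ : ∀ t, ∫ s, (f s * g (t - s)) • τ t =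
      (Set.Ioi (0 : ℝ)).indicator (fun t => convP c d t • T t x) t := by
    intro t
    rw [integral_smul_const, ← hconv]
    by_cases ht : t ∈ Set.Ioi (0 : ℝ)
    · rw [hτ, Set.indicator_of_mem ht, Set.indicator_of_mem ht]
    · rw [hτ, Set.indicator_of_notMem ht, Set.indicator_of_notMem ht, smul_zero]
  have hint := hF.integral_prod_left
  simp only [hconvτ] at hint
  refine ⟨(integrable_indicator_iff measurableSet_Ioi).1 hint, ?_⟩
  rw [← integral_indicator measurableSet_Ioi]
  simp only [← hconvτ]
  rw [integral_integral_swap hF, hS c]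
  change ∫ t in Set.Ioi (0 : ℝ), c t • T t (S d x) = _
  rw [← integral_indicator measurableSet_Ioi]
  congr 1
  ext s
  by_cases hs : s ∈ Set.Ioi (0 : ℝ)
  · rw [Set.indicator_of_mem hs, hS d,
      ← ContinuousLinearMap.integral_comp_comm _ (orbit_integrable hTcont hC d x), ← integral_smul]
    rw [← integral_add_right_eq_self (fun t => (f s * g (t - s)) • τ t) s]
    change ∫ t in Set.Ioi (0 : ℝ), c s • T s (d t • T t x) = _
    rw [← integral_indicator measurableSet_Ioi]
    congr 1
    ext t
    rw [add_sub_cancel_right]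
    by_cases ht : t ∈ Set.Ioi (0 : ℝ)
    · have hst : t + s ∈ Set.Ioi (0 : ℝ) := add_pos (Set.mem_Ioi.1 ht) hs
      rw [hτ, hf, hg, Set.indicator_of_mem ht, Set.indicator_of_mem ht, Set.indicator_of_mem hs,
        Set.indicator_of_mem hst, map_smul, smul_smul, add_comm t s,
        hTsemi s t (le_of_lt hs) (le_of_lt ht)]
      rfl
    · rw [hg, Set.indicator_of_notMem ht, Set.indicator_of_notMem ht, mul_zero, zero_smul]
  · rw [Set.indicator_of_notMem hs]
    simp [hf, Set.indicator_of_notMem hs]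

end Helpers

/-- **Proposition (the `γ₂*` functional calculus bound for bounded `C₀`-semigroups).**
For `b = Σⱼ cⱼ ∗ dⱼ`, one has `‖∫₀^∞ b(t) T_t dt‖ ≤ C² γ₂*(Σⱼ cⱼ ⊗ dⱼ)`; consequently
`c ⊗ d ↦ Γ(A, c ∗ d)` extends to a bounded operator
`σ_A : L¹(ℝ₊) ⊗_{γ₂*} L¹(ℝ₊) → B(H)` with `‖σ_A‖ ≤ C²`. -/
theorem sigmaA_bounded_by_gamma2star
    (H : Type) [NormedAddCommGroup H] [InnerProductSpace ℂ H] [CompleteSpace H]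
    (T : ℝ → (H →L[ℂ] H)) (hT0 : T 0 = 1)
    (hTsemi : ∀ s t : ℝ, 0 ≤ s → 0 ≤ t → T (s + t) = (T s).comp (T t))
    (hTcont : ∀ x : H, ContinuousOn (fun t => T t x) (Set.Ici (0 : ℝ)))
    (C : ℝ) (hC : ∀ t : ℝ, 0 ≤ t → ‖T t‖ ≤ C)
    (X : Type) [NormedAddCommGroup X] [NormedSpace ℂ X] [CompleteSpace X]
    (j : L1p →ₗ[ℂ] L1p →ₗ[ℂ] X)
    (hnorm : ∀ (N : ℕ) (c d : Fin N → L1p), ‖∑ i, j (c i) (d i)‖ = gamma2star c d)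
    (hdense : Dense (↑(Submodule.span ℂ {x : X | ∃ c d : L1p, x = j c d}) : Set X)) :
    (∀ (N : ℕ) (c d : Fin N → L1p) (Γb : H →L[ℂ] H),
      (∀ x : H, Γb x =
        ∫ t in Set.Ioi (0 : ℝ), (∑ i, convP ((c i) : ℝ → ℂ) ((d i) : ℝ → ℂ) t) • T t x) →
      ‖Γb‖ ≤ C ^ 2 * gamma2star c d) ∧
    ∃ σA : X →L[ℂ] (H →L[ℂ] H), ‖σA‖ ≤ C ^ 2 ∧
      ∀ (c d : L1p) (x : H),
        σA (j c d) x = ∫ t in Set.Ioi (0 : ℝ), convP (c : ℝ → ℂ) (d : ℝ → ℂ) t • T t x := by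
  have hC0 : 0 ≤ C := (norm_nonneg _).trans (hC 0 le_rfl)
  obtain ⟨S, hSn, hS⟩ := exists_S hTcont hC
  have hid := conv_identity hTsemi hTcont hC hS
  refine ⟨?_, ?_⟩
  · intro N c d Γb hΓ
    have : Γb = ∑ i, (S (c i)).comp (S (d i)) := by
      ext x
      rw [hΓ, ContinuousLinearMap.sum_apply]
      simp only [Finset.sum_smul]
      refine (integral_finsetSum _ (fun i _ => (hid (c i) (d i) x).1)).trans ?_
      exact Finset.sum_congr rfl fun i _ => (hid (c i) (d i) x).2.symm
    rw [this]
    exact S_sum_bound hTcont hC hSn hS c d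
  · let β : L1p →ₗ[ℂ] L1p →ₗ[ℂ] (H →L[ℂ] H) :=
      (LinearMap.mul ℂ (H →L[ℂ] H)).compl₁₂ S.toLinearMap S.toLinearMap
    let ψ := TensorProduct.lift β
    let φ := TensorProduct.lift j
    have hbound : ∀ z, ‖ψ z‖ ≤ C ^ 2 * ‖φ z‖ := by
      intro z
      obtain ⟨N, c, d, rfl⟩ := TensorProduct.exists_sum_tmul_eq z
      simp only [map_sum, ψ, φ, TensorProduct.lift.tmul]
      rw [hnorm]
      exact S_sum_bound hTcont hC hSn hS c d
    have hd : DenseRange φ := by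
      refine hdense.mono ?_
      change ((Submodule.span ℂ _ : Submodule ℂ X) : Set X) ⊆ (LinearMap.range φ : Set X)
      rw [SetLike.coe_subset_coe, Submodule.span_le]
      rintro _ ⟨c, d, rfl⟩
      exact ⟨c ⊗ₜ[ℂ] d, TensorProduct.lift.tmul _ _⟩
    refine ⟨ψ.extendOfNorm φ, LinearMap.opNorm_extendOfNorm_le hd (by positivity) hbound, ?_⟩
    intro c d x
    have h1 : j c d = φ (c ⊗ₜ[ℂ] d) := (TensorProduct.lift.tmul _ _).symm
    rw [h1, LinearMap.extendOfNorm_eq hd ⟨_, hbound⟩, ← (hid c d x).2]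
    simp only [ψ, TensorProduct.lift.tmul]
    rfl
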